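/- Let 𝒜 be a category with pullbacks, and let P be a pullback of g : Z ⟶ Y along f' : Z' ⟶ Y, with projections p : P ⟶ Z and q : P ⟶ Z'. Then there is a natural isomorphism of functors Over Z ⥤ Over Z' between (Over.map g) ⋙ (Over.pullback f') and (Over.pullback p) ⋙ (Over.map q); i.e., for x : A ⟶ Z in the slice over Z, pulling back g ∘ x along f' is naturally isomorphic to first pulling back x along p and then post-composing with q. (This Beck–Chevalley isomorphism provides the laxator for the slice indexed double category 𝒜_{/(−)} : Span(𝒜) → Cat, whose action on a span X ⟵f Z ⟶g Y is g_! f* : 𝒜_{/X} → 𝒜_{/Y}.) -/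

import Mathlib

/-!
STATEMENT 7: Beck–Chevalley.  If `P` is a pullback of `g : Z ⟶ Y` along
`f' : Z' ⟶ Y` with projections `p : P ⟶ Z` and `q : P ⟶ Z'`, then
`(Over.map g) ⋙ (Over.pullback f') ≅ (Over.pullback p) ⋙ (Over.map q)`
as functors `Over Z ⥤ Over Z'`.
-/

open CategoryTheory

universe v u

theorem beck_chevalley_for_slice_indexed_double_category
    {𝒜 : Type u} [Category.{v} 𝒜] [Limits.HasPullbacks 𝒜]
    {P Z Z' Y : 𝒜} (g : Z ⟶ Y) (f' : Z' ⟶ Y) (p : P ⟶ Z) (q : P ⟶ Z')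
    (hP : IsPullback p q g f') :
    Nonempty ((Over.map g ⋙ Over.pullback f') ≅ (Over.pullback p ⋙ Over.map q)) := by
  have key : ∀ A : Over Z, IsPullback (Limits.pullback.fst A.hom p)
      (Limits.pullback.snd A.hom p ≫ q) (A.hom ≫ g) f' :=
    fun A => (IsPullback.of_hasPullback A.hom p).paste_vert hP
  have h2 : ∀ A : Over Z, IsPullback (Limits.pullback.fst (A.hom ≫ g) f')
      (Limits.pullback.snd (A.hom ≫ g) f') (A.hom ≫ g) f' :=
    fun A => IsPullback.of_hasPullback _ _
  refine ⟨(NatIso.ofComponents (fun A => Over.isoMk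
    ((key A).isoIsPullback _ _ (h2 A)) ?_) ?_).symm⟩
  · exact (key A).isoIsPullback_hom_snd _ _ (h2 A)
  · intro A B k
    apply Over.OverMorphism.ext
    apply (h2 B).hom_ext
    · simp only [Functor.comp_map, Over.comp_left, Over.isoMk_hom_left, Category.assoc]
      refine (congrArg (_ ≫ ·) ((key B).isoIsPullback_hom_fst _ _ (h2 B))).trans ?_
      refine Eq.trans ?_ (congrArg (_ ≫ ·) (Limits.pullback.lift_fst _ _ _).symm)
      refine (Limits.pullback.lift_fst _ _ _).trans ?_
      exact ((key A).isoIsPullback_hom_fst_assoc _ _ (h2 A) _).symm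
    · simp only [Functor.comp_map, Over.comp_left, Over.isoMk_hom_left, Category.assoc]
      refine (congrArg (_ ≫ ·) ((key B).isoIsPullback_hom_snd _ _ (h2 B))).trans ?_
      refine Eq.trans ?_ (congrArg (_ ≫ ·) (Limits.pullback.lift_snd _ _ _).symm)
      refine (Limits.pullback.lift_snd_assoc _ _ _ _).trans ?_
      exact ((key A).isoIsPullback_hom_snd _ _ (h2 A)).symm
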